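/- arXiv:1704.00350 — 2 statements merged into one kernel-verified Lean document; each statement's English description precedes it below -/
import Mathlib

section
/- Let $v_1,\dots,v_n$ be real numbers with $\sum_{i=1}^n v_i^2 \le 1$. Then the fraction of sign vectors $(a_1,\dots,a_n) \in \{-1,+1\}^n$ for which $\left|\sum_{i=1}^n a_i v_i\right| \le 1$ is strictly greater than $\frac{13}{32}$. -/
noncomputable def sgE (f : ℝ → ℝ) : List ℝ → ℝ → ℝ
  | [], x => f x
  | u :: L, x => (sgE f L (x + u) + sgE f L (x - u)) / 2

noncomputable def indOne (x : ℝ) : ℝ := if |x| ≤ 1 then 1 else 0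

noncomputable def sqs (L : List ℝ) : ℝ := (L.map (fun u => u ^ 2)).sum

theorem sgE_perm (f : ℝ → ℝ) {L M : List ℝ} (h : L.Perm M) : ∀ x, sgE f L x = sgE f M x := by
  induction h with
  | nil => intro x; rfl
  | cons u _ ih => intro x; simp [sgE, ih]
  | swap u w L =>
    intro x
    simp only [sgE]
    rw [show x + w + u = x + u + w by ring, show x + w - u = x - u + w by ring,
      show x - w + u = x + u - w by ring, show x - w - u = x - u - w by ring]
    ring
  | trans _ _ h1 h2 => intro x; rw [h1, h2]

theorem sgE_abs (f : ℝ → ℝ) (L : List ℝ) : ∀ x, sgE f (L.map (fun u => |u|)) x = sgE f L x := by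
  induction L with
  | nil => intro x; rfl
  | cons u L ih =>
    intro x
    simp only [List.map_cons, sgE, ih]
    rcases abs_choice u with h | h <;> rw [h]
    rw [show x - -u = x + u by ring, show x + -u = x - u by ring]; ring

theorem sgE_mono {f g : ℝ → ℝ} (h : ∀ x, f x ≤ g x) (L : List ℝ) :
    ∀ x, sgE f L x ≤ sgE g L x := by
  induction L with
  | nil => intro x; exact h x
  | cons u L ih =>
    intro x
    simp only [sgE]
    linarith [ih (x + u), ih (x - u)]

theorem sgE_shift (f : ℝ → ℝ) (y : ℝ) (L : List ℝ) :
    ∀ x, sgE f L (x + y) = sgE (fun z => f (z + y)) L x := by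
  induction L with
  | nil => intro x; rfl
  | cons u L ih =>
    intro x
    simp only [sgE, ← ih]
    rw [show x + y + u = x + u + y by ring, show x + y - u = x - u + y by ring]

theorem sgE_neg (f : ℝ → ℝ) (L : List ℝ) :
    ∀ x, sgE f L (-x) = sgE (fun z => f (-z)) L x := by
  induction L with
  | nil => intro x; rfl
  | cons u L ih =>
    intro x
    simp only [sgE, ← ih]
    rw [show -x + u = -(x - u) by ring, show -x - u = -(x + u) by ring]; ring

theorem sgE_add (f g : ℝ → ℝ) (L : List ℝ) :
    ∀ x, sgE (fun z => f z + g z) L x = sgE f L x + sgE g L x := by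
  induction L with
  | nil => intro x; rfl
  | cons u L ih => intro x; simp only [sgE, ih]; ring

theorem sqs_nonneg (L : List ℝ) : 0 ≤ sqs L := by
  apply List.sum_nonneg
  intro x hx
  obtain ⟨u, _, rfl⟩ := List.mem_map.1 hx
  positivity

theorem sqs_cons (u : ℝ) (L : List ℝ) : sqs (u :: L) = u ^ 2 + sqs L := by simp [sqs]

theorem sqs_append (L M : List ℝ) : sqs (L ++ M) = sqs L + sqs M := by simp [sqs]

theorem sqs_perm {L M : List ℝ} (h : L.Perm M) : sqs L = sqs M := (h.map _).sum_eq

theorem sgE_fourth (C : ℝ) (hC : 0 ≤ C) (L : List ℝ) :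
    ∀ z, 1 - C * (z ^ 4 + 6 * z ^ 2 * sqs L + 3 * sqs L ^ 2) ≤
      sgE (fun y => 1 - C * y ^ 4) L z := by
  induction L with
  | nil => intro z; simp [sgE, sqs]
  | cons u L ih =>
    intro z
    simp only [sgE, sqs_cons]
    have h1 := ih (z + u)
    have h2 := ih (z - u)
    have h3 : 0 ≤ C * u ^ 4 := by positivity
    nlinarith

theorem sgE_indOne_neg (L : List ℝ) (x : ℝ) : sgE indOne L (-x) = sgE indOne L x := by
  rw [sgE_neg]; congr 1; funext z; simp [indOne]

theorem sgE_indOne_abs (L : List ℝ) (x : ℝ) : sgE indOne L |x| = sgE indOne L x := by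
  rcases abs_choice x with h | h <;> rw [h]
  exact sgE_indOne_neg L x

theorem stop_bound (L : List ℝ) (x : ℝ) (h0 : 0 ≤ x) (h1 : x ≤ 1) :
    1 - ((1 + x) ^ 4)⁻¹ * (3 * sqs L ^ 2) ≤ 2 * sgE indOne L x := by
  have e1 : sgE indOne L x = sgE (fun z => indOne (z + x)) L 0 := by
    rw [← sgE_shift]; simp
  have e2 : sgE indOne L x = sgE (fun z => indOne (-z + x)) L 0 := by
    rw [e1]
    have := sgE_neg (fun z => indOne (z + x)) L 0
    simpa using this
  have e3 : 2 * sgE indOne L x = sgE (fun z => indOne (z + x) + indOne (-z + x)) L 0 := by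
    rw [sgE_add, ← e1, ← e2]; ring
  rw [e3]
  have hC : 0 ≤ ((1 + x) ^ 4)⁻¹ := by positivity
  refine le_trans ?_ (le_trans (sgE_fourth _ hC L 0) (sgE_mono ?_ L 0))
  · simp
  · intro z
    have i1 : 0 ≤ indOne (z + x) := by unfold indOne; split_ifs <;> norm_num
    have i2 : 0 ≤ indOne (-z + x) := by unfold indOne; split_ifs <;> norm_num
    by_cases hz : |z| ≤ 1 + x
    · have hz' := abs_le.1 hz
      have : 0 ≤ ((1 + x) ^ 4)⁻¹ * z ^ 4 := by positivity
      rcases le_total 0 z with h | h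
      · have : indOne (-z + x) = 1 := by
          unfold indOne; rw [if_pos]; rw [abs_le]; constructor <;> linarith
        linarith
      · have : indOne (z + x) = 1 := by
          unfold indOne; rw [if_pos]; rw [abs_le]; constructor <;> linarith
        linarith
    · have h4 : (1 + x) ^ 4 ≤ z ^ 4 := by
        have : (1 + x) ^ 4 ≤ |z| ^ 4 := by gcongr; linarith
        rwa [Even.pow_abs (by decide)] at this
      have hp : 0 < (1 + x) ^ 4 := by positivity
      have : 1 ≤ ((1 + x) ^ 4)⁻¹ * z ^ 4 := by
        rw [inv_mul_eq_div, le_div_iff₀ hp]; linarith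
      linarith

theorem conc_aux (A B P Q q : ℝ) (hA : 0 < A) (hq : q ≤ Q) (hQ : Q ≤ 1) (hq1 : q < 1)
    (h1 : 48 * (1 - q) ^ 2 < A * (B - 4 * q)) (h2 : 0 < A * (B - 4)) :
    48 * (1 - Q) ^ 2 < A * (B - 4 * Q) := by
  obtain ⟨s, hs⟩ : ∃ s, s * (1 - q) = 1 - Q := ⟨(1 - Q) / (1 - q), div_mul_cancel₀ _ (by linarith)⟩
  have hs0 : 0 ≤ s := by
    by_contra h; push Not at h; nlinarith
  have hs1 : s ≤ 1 := by
    by_contra h; push Not at h; nlinarith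
  have hQs : Q = 1 - s * (1 - q) := by linarith
  rw [hQs]
  have k1 : 48 * (1 - (1 - s * (1 - q))) ^ 2 ≤ s * (48 * (1 - q) ^ 2) := by
    have : 0 ≤ s * (1 - s) * (48 * (1 - q) ^ 2) := by
      have := sub_nonneg.2 hs1
      positivity
    nlinarith
  have k2 : A * (B - 4 * (1 - s * (1 - q))) = s * (A * (B - 4 * q)) + (1 - s) * (A * (B - 4)) := by
    ring
  rw [k2]
  rcases hs0.eq_or_lt with h | h
  · subst h; nlinarith
  · nlinarith [mul_lt_mul_of_pos_left h1 h, mul_nonneg (sub_nonneg.2 hs1) h2.le]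

theorem poly1 (x : ℝ) (h0 : 2 / 3 ≤ x) (h1 : x ≤ 1) :
    48 * (1 - x * (1 - x)) ^ 2 < (1 + x) ^ 4 * (3 + 4 * x ^ 2 - 4 * (x * (1 - x))) := by
  obtain ⟨y, rfl⟩ : ∃ y, x = 2 / 3 + y := ⟨x - 2 / 3, by ring⟩
  have hy : 0 ≤ y := by linarith
  have hy1 : y ≤ 1 / 3 := by linarith
  have := pow_nonneg hy 2
  have := pow_nonneg hy 3
  have := pow_nonneg hy 4
  have := pow_nonneg hy 5
  have := pow_nonneg hy 6
  nlinarith [mul_nonneg hy (sub_nonneg.2 hy1), mul_nonneg (pow_nonneg hy 2) (sub_nonneg.2 hy1),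
    mul_nonneg (pow_nonneg hy 3) (sub_nonneg.2 hy1)]

theorem poly2 (x : ℝ) (h0 : 1 / 2 ≤ x) (h1 : x ≤ 2 / 3) :
    48 * (1 - 3 * (1 - x) ^ 2) ^ 2 < (1 + x) ^ 4 * (3 + 4 * x ^ 2 - 4 * (3 * (1 - x) ^ 2)) := by
  obtain ⟨y, rfl⟩ : ∃ y, x = 1 / 2 + y := ⟨x - 1 / 2, by ring⟩
  have hy : 0 ≤ y := by linarith
  have hy1 : y ≤ 1 / 6 := by linarith
  have := pow_nonneg hy 2
  have := pow_nonneg hy 3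
  have := pow_nonneg hy 4
  have := pow_nonneg hy 5
  have := pow_nonneg hy 6
  nlinarith [mul_nonneg hy (sub_nonneg.2 hy1), mul_nonneg (pow_nonneg hy 2) (sub_nonneg.2 hy1),
    mul_nonneg (pow_nonneg hy 3) (sub_nonneg.2 hy1), mul_nonneg (pow_nonneg hy 4) (sub_nonneg.2 hy1),
    mul_nonneg (pow_nonneg hy 5) (sub_nonneg.2 hy1)]

theorem stop_ineq (x Q : ℝ) (h0 : 1 / 2 < x) (h1 : x ≤ 1) (hQ : Q ≤ 1)
    (hQx : x * (1 - x) ≤ Q) (hor : 2 / 3 ≤ x ∨ 3 * (1 - x) ^ 2 ≤ Q) :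
    48 * (1 - Q) ^ 2 < (1 + x) ^ 4 * (3 + 4 * x ^ 2 - 4 * Q) := by
  have hA : 0 < (1 + x) ^ 4 := by positivity
  have h2 : 0 < (1 + x) ^ 4 * (3 + 4 * x ^ 2 - 4) := by
    apply mul_pos hA; nlinarith
  by_cases hx : 2 / 3 ≤ x
  · exact conc_aux _ _ 0 Q _ hA hQx hQ (by nlinarith) (poly1 x hx h1) h2
  · push Not at hx
    have h3 : 3 * (1 - x) ^ 2 ≤ Q := by
      rcases hor with h | h
      · linarith
      · exact h
    exact conc_aux _ _ 0 Q _ hA h3 hQ (by nlinarith) (poly2 x h0.le hx.le) h2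

theorem end_case (x Q a c : ℝ) (hx0 : 0 ≤ x) (hx : x ≤ 1) (hc : 0 ≤ c) (hca : c ≤ a) (ha : a ≤ 1)
    (hQ : Q + a ^ 2 + c ^ 2 ≤ 1) : 13 / 32 + (Q - x ^ 2) / 8 < sgE indOne [a, c] x := by
  simp only [sgE]
  have nn : ∀ z, 0 ≤ indOne z := fun z => by unfold indOne; split_ifs <;> norm_num
  have one : ∀ z, -1 ≤ z → z ≤ 1 → indOne z = 1 := fun z h1 h2 => by
    unfold indOne; rw [if_pos (abs_le.2 ⟨h1, h2⟩)]
  have p1 := nn (x + a + c)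
  have p2 := nn (x + a - c)
  have p3 := one (x - a + c) (by linarith) (by linarith)
  have p4 := nn (x - a - c)
  rw [p3]
  by_cases hq : Q < 3 / 4 + x ^ 2
  · by_cases h : a + c ≤ 1 + x
    · rw [one (x - a - c) (by linarith) (by linarith)]; linarith
    · rw [one (x + a - c) (by linarith) (by linarith)]; linarith
  · push Not at hq
    have ha2 : a ≤ 1 / 2 := by nlinarith
    have hx2 : x ≤ 1 / 2 := by nlinarith
    rw [one (x - a - c) (by linarith) (by linarith), one (x + a - c) (by linarith) (by linarith)]
    nlinarith

theorem main_ind (a c : ℝ) (hc : 0 ≤ c) (hca : c ≤ a) (ha : a ≤ 1) (M : List ℝ) :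
    ∀ (k : ℕ) (x Q : ℝ), 2 ≤ k → M.Pairwise (· ≥ ·) → (∀ u ∈ M, 0 ≤ u ∧ u ≤ 1 / 2) → |x| ≤ 1 →
      (∀ u ∈ M, k * u ^ 2 ≤ Q) → x ^ 2 ≤ k * Q →
      (3 ≤ k ∨ ∀ u ∈ M, 1 < |x| + u → 2 / 3 ≤ |x|) →
      0 ≤ Q → Q + sqs M + a ^ 2 + c ^ 2 ≤ 1 →
      13 / 32 + (Q - x ^ 2) / 8 < sgE indOne (M ++ [a, c]) x := by
  induction M with
  | nil =>
    intro k x Q _ _ _ hx _ _ _ _ hQ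
    rw [List.nil_append, ← sgE_indOne_abs, ← sq_abs x]
    simp [sqs] at hQ
    exact end_case _ _ _ _ (abs_nonneg x) hx hc hca ha hQ
  | cons u M ih =>
    intro k x Q hk2 hs hb hx hk hxk hor hQ0 hQ
    rw [sqs_cons] at hQ
    have hsM := sqs_nonneg M
    obtain ⟨hu0, hu1⟩ := hb u (by simp)
    have hku := hk u (by simp)
    rw [List.pairwise_cons] at hs
    by_cases hfit : |x| + u ≤ 1
    · have key : ∀ y : ℝ, |y| ≤ |x| + u → y ^ 2 ≤ (k + 1) * (Q + u ^ 2) → 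
          13 / 32 + (Q + u ^ 2 - y ^ 2) / 8 < sgE indOne (M ++ [a, c]) y := by
        intro y hy hy2
        apply ih (k + 1) y (Q + u ^ 2) (by omega) hs.2 (fun w hw => hb w (by simp [hw]))
          (hy.trans hfit)
        · intro w hw
          have h1 := hs.1 w hw
          have h2 := (hb w (by simp [hw])).1
          have : w ^ 2 ≤ u ^ 2 := by gcongr
          have h3 := hk w (by simp [hw])
          push_cast; linarith
        · push_cast; exact hy2
        · left; omega
        · positivity
        · linarith
      have hcs : (|x| + u) ^ 2 ≤ (k + 1) * (Q + u ^ 2) := by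
        have h1 : (2 * |x| * u) ^ 2 ≤ (Q + k * u ^ 2) ^ 2 := by
          have : x ^ 2 * u ^ 2 ≤ k * Q * u ^ 2 := by gcongr
          rw [mul_pow, mul_pow, sq_abs]
          nlinarith [sq_nonneg (Q - k * u ^ 2)]
        have h2 := (le_abs_self _).trans (abs_le_of_sq_le_sq h1 (by positivity))
        nlinarith [sq_abs x]
      have b1 : |x + u| ≤ |x| + u := by
        have := abs_add_le x u; rwa [abs_of_nonneg hu0] at this
      have b2 : |x - u| ≤ |x| + u := by
        have := abs_sub x u; rwa [abs_of_nonneg hu0] at this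
      have c1 := key (x + u) b1 (by rw [← sq_abs]; exact le_trans (by gcongr) hcs)
      have c2 := key (x - u) b2 (by rw [← sq_abs]; exact le_trans (by gcongr) hcs)
      simp only [List.cons_append, sgE]
      nlinarith
    · push Not at hfit
      rw [← sgE_indOne_abs, ← sq_abs x]
      rw [← sq_abs x] at hxk
      have hsq := stop_bound ((u :: M) ++ [a, c]) |x| (abs_nonneg x) hx
      have hR0 := sqs_nonneg ((u :: M) ++ [a, c])
      have hR : sqs ((u :: M) ++ [a, c]) ≤ 1 - Q := by
        rw [sqs_append, sqs_cons]
        have : sqs [a, c] = a ^ 2 + c ^ 2 := by simp [sqs]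
        rw [this]
        linarith
      have hor2 : 2 / 3 ≤ |x| ∨ (3:ℝ) ≤ k := by
        rcases hor with h | h
        · right; exact_mod_cast h
        · left; exact h u (by simp) hfit
      generalize |x| = X at *
      generalize sqs ((u :: M) ++ [a, c]) = R at *
      have h12 : 1 / 2 < X := by linarith
      have hu2 : (1 - X) ^ 2 ≤ u ^ 2 := by
        apply pow_le_pow_left₀ <;> linarith
      have hQx : X * (1 - X) ≤ Q := by
        have : (X * (1 - X)) ^ 2 ≤ Q ^ 2 := by
          rw [mul_pow]
          calc X ^ 2 * (1 - X) ^ 2 ≤ (k * Q) * u ^ 2 := by gcongr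
            _ = Q * (k * u ^ 2) := by ring
            _ ≤ Q * Q := by gcongr
            _ = Q ^ 2 := by ring
        exact (le_abs_self _).trans (abs_le_of_sq_le_sq this hQ0)
      have hin := stop_ineq X Q h12 hx (by linarith) hQx (by
        rcases hor2 with h | h
        · left; exact h
        · right
          calc 3 * (1 - X) ^ 2 ≤ k * u ^ 2 := by gcongr
            _ ≤ Q := hku)
      have hA : 0 < (1 + X) ^ 4 := by positivity
      have h3 : ((1 + X) ^ 4)⁻¹ * (3 * R ^ 2) < (3 + 4 * X ^ 2 - 4 * Q) / 16 := by
        rw [inv_mul_eq_div, div_lt_iff₀ hA]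
        have : R ^ 2 ≤ (1 - Q) ^ 2 := by gcongr
        linarith
      linarith

theorem sgE_zero (f : ℝ → ℝ) (L : List ℝ) (x : ℝ) : sgE f (0 :: L) x = sgE f L x := by
  simp [sgE]

theorem sgE_ofFn (f : ℝ → ℝ) : ∀ (n : ℕ) (v : Fin n → ℝ) (x : ℝ),
    sgE f (List.ofFn v) x =
      (∑ a : Fin n → Bool, f (x + ∑ i, (if a i then (1:ℝ) else -1) * v i)) / 2 ^ n := by
  intro n
  induction n with
  | zero => intro v x; simp [sgE]
  | succ n ih =>
    intro v x
    rw [List.ofFn_succ, sgE, ih, ih, ← (Fin.consEquiv (fun _ => Bool)).sum_comp,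
      Fintype.sum_prod_type]
    simp only [Fintype.sum_bool, Fin.consEquiv_apply, Fin.sum_univ_succ, Fin.cons_zero,
      Fin.cons_succ, if_true, one_mul, add_assoc, sub_eq_add_neg, neg_mul, Bool.false_eq_true,
      if_false]
    rw [pow_succ]
    field_simp

theorem sorted_case (a b c d : ℝ) (M : List ℝ) (h : (a :: b :: c :: d :: M).Pairwise (· ≥ ·))
    (h0 : ∀ u ∈ a :: b :: c :: d :: M, 0 ≤ u) (hQ : sqs (a :: b :: c :: d :: M) ≤ 1) :
    13 / 32 < sgE indOne (a :: b :: c :: d :: M) 0 := by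
  have hp : (a :: b :: c :: d :: M).Perm (b :: d :: (M ++ [a, c])) := by
    rw [← Multiset.coe_eq_coe]
    simp only [← Multiset.cons_coe, ← Multiset.coe_add, ← Multiset.singleton_add]
    simp only [Multiset.coe_nil, add_zero]
    abel
  rw [sgE_perm _ hp]
  simp only [List.pairwise_cons] at h
  obtain ⟨ha, hb, hc, hd, hM⟩ := h
  have hab : b ≤ a := ha b (by simp)
  have hbc : c ≤ b := hb c (by simp)
  have hcd : d ≤ c := hc d (by simp)
  have hd0 : 0 ≤ d := h0 d (by simp)
  simp only [sqs_cons] at hQ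
  have hsM := sqs_nonneg M
  have ha1 : a ≤ 1 := by nlinarith
  have hd1 : d ≤ 1 / 2 := by nlinarith
  have hb0 : 0 ≤ b := by linarith
  have hbd : b + d ≤ 1 := by
    have : a ^ 2 ≥ b ^ 2 := by gcongr
    have : c ^ 2 ≥ d ^ 2 := by gcongr
    nlinarith [sq_nonneg (b - d)]
  have key : ∀ y : ℝ, (|y| = b + d ∨ |y| = b - d) →
      13 / 32 + (b ^ 2 + d ^ 2 - y ^ 2) / 8 < sgE indOne (M ++ [a, c]) y := by
    intro y hy
    apply main_ind a c (by linarith) (by linarith) ha1 M 2 y (b ^ 2 + d ^ 2) le_rfl hM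
    · intro u hu
      exact ⟨h0 u (by simp [hu]), (hd u hu).le.trans hd1⟩
    · rcases hy with hy | hy <;> rw [hy] <;> linarith
    · intro u hu
      have h1 := hd u hu
      have h2 := h0 u (by simp [hu])
      push_cast
      nlinarith
    · rw [← sq_abs]
      push_cast
      rcases hy with hy | hy <;> rw [hy] <;> nlinarith [sq_nonneg (b - d), sq_nonneg (b + d)]
    · right
      intro u hu h1
      have h2 := hd u hu
      rcases hy with hy | hy <;> rw [hy] at h1 ⊢ <;> linarith
    · positivity
    · linarith
  have abd : |b + d| = b + d := abs_of_nonneg (by linarith)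
  have abd2 : |b - d| = b - d := abs_of_nonneg (by linarith)
  have k1 := key (0 + b + d) (by left; rw [zero_add, abd])
  have k2 := key (0 + b - d) (by right; rw [zero_add, abd2])
  have k3 := key (0 - b + d) (by right; rw [← abd2, ← abs_neg]; congr 1; ring)
  have k4 := key (0 - b - d) (by left; rw [← abd, ← abs_neg]; congr 1; ring)
  simp only [sgE]
  linarith

theorem list_case (L : List ℝ) (hQ : sqs L ≤ 1) : 13 / 32 < sgE indOne L 0 := by
  let N := 0 :: 0 :: 0 :: 0 :: L.map (fun u => |u|)
  have hN : sgE indOne L 0 = sgE indOne N 0 := by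
    simp only [N, sgE_zero, sgE_abs]
  have hp : (N.insertionSort (· ≥ ·)).Perm N := List.perm_insertionSort _ _
  have hs : (N.insertionSort (· ≥ ·)).Pairwise (· ≥ ·) := List.pairwise_insertionSort _ _
  rw [hN, ← sgE_perm _ hp]
  have hlen : 4 ≤ (N.insertionSort (· ≥ ·)).length := by
    rw [hp.length_eq]; simp [N]
  have hq : sqs (N.insertionSort (· ≥ ·)) ≤ 1 := by
    rw [sqs_perm hp]
    simp only [N, sqs_cons]
    have : sqs (L.map (fun u => |u|)) = sqs L := by
      simp [sqs, Function.comp_def]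
    rw [this]; linarith
  have h0 : ∀ u ∈ N.insertionSort (· ≥ ·), 0 ≤ u := by
    intro u hu
    rw [hp.mem_iff] at hu
    simp only [N, List.mem_cons, List.mem_map] at hu
    rcases hu with rfl | rfl | rfl | rfl | ⟨w, _, rfl⟩
    · exact le_rfl
    · exact le_rfl
    · exact le_rfl
    · exact le_rfl
    · exact abs_nonneg w
  generalize N.insertionSort (· ≥ ·) = K at *
  match K, hlen, hs, h0, hq with
  | a :: b :: c :: d :: M, _, hs, h0, hq => exact sorted_case a b c d M hs h0 hq

theorem main_13_32 (n : ℕ) (v : Fin n → ℝ) (hv : ∑ i, v i ^ 2 ≤ 1) :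
    (13 : ℝ) / 32 <
      (∑ a : Fin n → Bool,
        if |∑ i, (if a i then (1:ℝ) else -1) * v i| ≤ 1 then (1:ℝ) else 0) / 2 ^ n := by
  have h1 : sqs (List.ofFn v) ≤ 1 := by
    simpa [sqs, List.map_ofFn, List.sum_ofFn, Function.comp_def] using hv
  have h2 := list_case _ h1
  rw [sgE_ofFn] at h2
  simpa only [indOne, zero_add] using h2
end

section
/- Let $c \ge 0$, $p \ge 2$, and $B_p = \frac{2^{p/2}\Gamma(\frac{p+1}{2})}{\sqrt{\pi}}$. Let $x$ be real with $|x| \le 1$, and let $v_1,\dots,v_n$ be reals with $\sum_{i=1}^n v_i^2 \le c(1+|x|)^2$. Let $a_1,\dots,a_n$ be independent uniform random signs and $Y = \sum_{i=1}^n a_i v_i$. Then $\Pr[|x+Y| \le 1] \ge \frac{1}{2}(1 - B_p c^{p/2})$. -/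
open MeasureTheory ProbabilityTheory
noncomputable def radE (n : ℕ) (v : Fin n → ℝ) (f : ℝ → ℝ) (x : ℝ) : ℝ :=
  (∑ a : Fin n → Bool, f (x + ∑ i, (if a i then (1:ℝ) else -1) * v i)) / 2 ^ n

lemma radE_zero (v : Fin 0 → ℝ) (f : ℝ → ℝ) (x : ℝ) : radE 0 v f x = f x := by
  simp [radE]

lemma radE_succ (n : ℕ) (v : Fin (n+1) → ℝ) (f : ℝ → ℝ) (x : ℝ) :
    radE (n+1) v f x =
      (radE n (fun i => v i.succ) f (x + v 0) + radE n (fun i => v i.succ) f (x - v 0)) / 2 := by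
  unfold radE
  rw [← (Fin.consEquiv (fun _ : Fin (n+1) => Bool)).sum_comp, Fintype.sum_prod_type]
  simp only [Fin.consEquiv, Equiv.coe_fn_mk, Fin.sum_univ_succ, Fin.cons_zero, Fin.cons_succ,
    Fintype.sum_bool]
  simp only [if_true, Bool.false_eq_true, if_false, one_mul, neg_one_mul, ← add_assoc, ← sub_eq_add_neg]
  field_simp
  ring

lemma radE_mono (n : ℕ) (v : Fin n → ℝ) (f g : ℝ → ℝ) (x : ℝ) (h : ∀ y, f y ≤ g y) :
    radE n v f x ≤ radE n v g x := by
  unfold radE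
  gcongr
  exact h _

lemma radE_sq (n : ℕ) : ∀ (v : Fin n → ℝ) (x : ℝ),
    radE n v (fun y => y ^ 2) x = x ^ 2 + ∑ i, v i ^ 2 := by
  induction n with
  | zero => intro v x; simp [radE_zero]
  | succ n ih => intro v x; rw [radE_succ, ih, ih, Fin.sum_univ_succ]; ring

lemma radE_cos (l : ℝ) (n : ℕ) : ∀ (v : Fin n → ℝ) (x : ℝ),
    radE n v (fun y => Real.cos (l * y)) x = Real.cos (l * x) * ∏ i, Real.cos (l * v i) := by
  induction n with
  | zero => intro v x; simp [radE_zero]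
  | succ n ih =>
    intro v x
    rw [radE_succ, ih, ih, Fin.prod_univ_succ, mul_add, mul_sub, Real.cos_add, Real.cos_sub]; ring

lemma radE_lin (n : ℕ) (v : Fin n → ℝ) (f g : ℝ → ℝ) (x a b c : ℝ) :
    radE n v (fun y => a * f y + b * g y + c) x = a * radE n v f x + b * radE n v g x + c := by
  unfold radE
  simp only [Finset.sum_add_distrib, ← Finset.mul_sum]
  simp
  field_simp

/-- the tail probability -/
noncomputable def ind (y : ℝ) : ℝ := if |y| ≤ 1 then 0 else 1

/-- reduction to a tail bound -/
lemma reduction (n : ℕ) (x : ℝ) (hx : |x| ≤ 1) (v : Fin n → ℝ) :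
    (1 / 2) * (1 - radE n (fun i => v i / (1 + |x|)) ind 0) ≤
      (∑ a : Fin n → Bool,
        if |x + ∑ i, (if a i then (1:ℝ) else -1) * v i| ≤ 1 then (1:ℝ) else 0) / 2 ^ n := by
  have ht : 0 < 1 + |x| := by positivity
  set S := ∑ a : Fin n → Bool,
        if |x + ∑ i, (if a i then (1:ℝ) else -1) * v i| ≤ 1 then (1:ℝ) else 0 with hS
  have hS' : S = ∑ a : Fin n → Bool,
        if |x - ∑ i, (if a i then (1:ℝ) else -1) * v i| ≤ 1 then (1:ℝ) else 0 := by
    rw [hS]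
    refine Fintype.sum_equiv (Equiv.arrowCongr (Equiv.refl _) Equiv.boolNot) _ _ fun a => ?_
    have : ∑ i, (if a i then (1:ℝ) else -1) * v i = - ∑ i, (if (Equiv.arrowCongr (Equiv.refl _) Equiv.boolNot) a i then (1:ℝ) else -1) * v i := by
      rw [← Finset.sum_neg_distrib]
      refine Finset.sum_congr rfl fun i _ => ?_
      simp [Equiv.arrowCongr]
      cases a i <;> simp
    rw [this, sub_eq_add_neg]
  have h2 : (2:ℝ) ^ n - ∑ a : Fin n → Bool, ind (0 + ∑ i, (if a i then (1:ℝ) else -1) * (v i / (1 + |x|))) ≤ S + S := by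
    nth_rw 2 [hS']
    rw [hS, ← Finset.sum_add_distrib]
    have : (2:ℝ)^n = ∑ a : Fin n → Bool, (1:ℝ) := by simp
    rw [this, ← Finset.sum_sub_distrib]
    refine Finset.sum_le_sum fun a _ => ?_
    have e : (0 + ∑ i, (if a i then (1:ℝ) else -1) * (v i / (1 + |x|))) = (∑ i, (if a i then (1:ℝ) else -1) * v i) / (1 + |x|) := by
      rw [zero_add, Finset.sum_div]; simp only [mul_div_assoc]
    rw [e]
    generalize (∑ i, (if a i then (1:ℝ) else -1) * v i) = Y
    unfold ind
    simp only [abs_div, abs_of_pos ht, div_le_one ht]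
    by_cases hY : |Y| ≤ 1 + |x|
    · rw [if_pos hY]
      by_cases h : |x + Y| ≤ 1
      · rw [if_pos h]; split_ifs <;> norm_num
      · have : |x - Y| ≤ 1 := by
          by_contra h'
          apply h
          rw [abs_le] at hx ⊢
          rw [abs_le] at h'
          rw [abs_le] at h
          rcases abs_cases x with h1 | h1 <;> rcases abs_cases Y with h2 | h2 <;> grind
        rw [if_pos this]; split_ifs <;> norm_num
    · rw [if_neg hY]; split_ifs <;> norm_num
  unfold radE
  have h3 : (0:ℝ) < 2 ^ n := by positivity
  have : (1 / 2 : ℝ) * (1 - (∑ a : Fin n → Bool, ind (0 + ∑ i, (if a i then (1:ℝ) else -1) * (v i / (1 + |x|)))) / 2 ^ n)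
     = ((2:ℝ) ^ n - ∑ a : Fin n → Bool, ind (0 + ∑ i, (if a i then (1:ℝ) else -1) * (v i / (1 + |x|)))) / 2 / 2 ^ n := by
    field_simp
  rw [this]
  gcongr
  linarith


lemma deriv_abs_mul (q : ℝ) (hq : 1 ≤ q) (y : ℝ) :
    HasDerivAt (fun y : ℝ => |y| ^ q * y) ((q + 1) * |y| ^ q) y := by
  have hne : ∀ y : ℝ, y ≠ 0 → HasDerivAt (fun y : ℝ => |y| ^ q * y) ((q + 1) * |y| ^ q) y := by
    intro y hy
    have h1 : HasDerivAt (fun y : ℝ => |y|) (SignType.sign y : ℝ) y := hasDerivAt_abs hy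
    have h2 := (h1.rpow_const (p := q) (Or.inr hq)).mul (hasDerivAt_id y)
    refine h2.congr_deriv ?_
    have h3 : (0:ℝ) < |y| := abs_pos.2 hy
    have h4 : |y| ^ q = |y| ^ (q - 1) * |y| := by
      rw [← Real.rpow_add_one h3.ne']; simp
    have h5 : (SignType.sign y : ℝ) * y = |y| := sign_mul_self y
    simp only [id]
    rw [h4]
    linear_combination q * |y| ^ (q-1) * h5
  rcases eq_or_ne y 0 with rfl | hy
  · have hc : Continuous (fun y : ℝ => |y| ^ q) := by
      apply Continuous.rpow_const continuous_abs; intro; right; linarith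
    refine hasDerivAt_of_hasDerivAt_of_ne (g := fun y => (q + 1) * |y| ^ q) hne ?_ ?_
    · exact (hc.mul continuous_id).continuousAt
    · exact (continuous_const.mul hc).continuousAt
  · exact hne y hy

lemma phi_mono (q : ℝ) (hq : 1 ≤ q) (x a b : ℝ) (ha : 0 ≤ a) (hab : a ≤ b) :
    |x + a| ^ q + |x - a| ^ q ≤ |x + b| ^ q + |x - b| ^ q := by
  rcases hab.eq_or_lt with rfl | hab
  · rfl
  have hb : 0 < b := by linarith
  have hcv : ConvexOn ℝ Set.univ (fun y : ℝ => |y| ^ q) := by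
    have h1 : ConvexOn ℝ Set.univ (fun y : ℝ => |y|) := convexOn_norm convex_univ
    have h2 := (convexOn_rpow hq)
    have h3 : (fun y : ℝ => |y|) '' Set.univ ⊆ Set.Ici 0 := by rintro _ ⟨y, _, rfl⟩; exact abs_nonneg y
    refine ⟨convex_univ, fun y _ z _ s t hs ht hst => ?_⟩
    simp only
    refine le_trans (Real.rpow_le_rpow (abs_nonneg _) (h1.2 trivial trivial hs ht hst) (by linarith)) ?_
    exact h2.2 (abs_nonneg y) (abs_nonneg z) hs ht hst
  have w1 : 0 ≤ (b + a) / (2 * b) := by positivity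
  have w2 : 0 ≤ (b - a) / (2 * b) := by apply div_nonneg <;> linarith
  have w3 : (b + a) / (2 * b) + (b - a) / (2 * b) = 1 := by field_simp; ring
  have e1 := hcv.2 (Set.mem_univ (x + b)) (Set.mem_univ (x - b)) w1 w2 w3
  have e2 := hcv.2 (Set.mem_univ (x + b)) (Set.mem_univ (x - b)) w2 w1 (by linarith)
  simp only [smul_eq_mul] at e1 e2
  have f1 : (b + a) / (2 * b) * (x + b) + (b - a) / (2 * b) * (x - b) = x + a := by field_simp; ring
  have f2 : (b - a) / (2 * b) * (x + b) + (b + a) / (2 * b) * (x - b) = x - a := by field_simp; ring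
  rw [f1] at e1
  rw [f2] at e2
  linear_combination e1 + e2 + (|x + b| ^ q + |x - b| ^ q) * w3

noncomputable def DD (p x a : ℝ) : ℝ := |x + a| ^ (p-2) * (x + a) - |x - a| ^ (p-2) * (x - a)

lemma DD_deriv (p : ℝ) (hp : 3 ≤ p) (x a : ℝ) :
    HasDerivAt (DD p x) ((p - 1) * (|x + a| ^ (p-2) + |x - a| ^ (p-2))) a := by
  have h1 := (deriv_abs_mul (p-2) (by linarith) (x + a)).comp_const_add x a
  have h2 := (deriv_abs_mul (p-2) (by linarith) (x - a)).comp_const_sub x a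
  refine (h1.sub h2).congr_deriv ?_
  ring

lemma DD_convex (p : ℝ) (hp : 3 ≤ p) (x : ℝ) : ConvexOn ℝ (Set.Ici 0) (DD p x) := by
  refine MonotoneOn.convexOn_of_deriv (convex_Ici 0)
    (fun a _ => (DD_deriv p hp x a).continuousAt.continuousWithinAt)
    (fun a _ => (DD_deriv p hp x a).differentiableAt.differentiableWithinAt) ?_
  intro a ha b hb hab
  rw [(DD_deriv p hp x a).deriv, (DD_deriv p hp x b).deriv]
  rw [interior_Ici] at ha
  have := phi_mono (p-2) (by linarith) x a b (le_of_lt ha) hab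
  have : 0 ≤ p - 1 := by linarith
  gcongr

noncomputable def psi (p x t : ℝ) : ℝ := |x + √t| ^ p + |x - √t| ^ p

lemma psi_deriv (p : ℝ) (hp : 3 ≤ p) (x t : ℝ) (ht : 0 < t) :
    HasDerivAt (psi p x) (p / 2 * (DD p x (√t) / √t)) t := by
  have hs := Real.hasDerivAt_sqrt ht.ne'
  have h1 := ((hasDerivAt_abs_rpow (x + √t) (p := p) (by linarith)).comp_const_add x (√t)).comp t hs
  have h2 := ((hasDerivAt_abs_rpow (x - √t) (p := p) (by linarith)).comp_const_sub x (√t)).comp t hs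
  refine (h1.add h2).congr_deriv ?_
  have : 0 < √t := Real.sqrt_pos.2 ht
  unfold DD
  field_simp
  ring

lemma psi_cont (p : ℝ) (hp : 3 ≤ p) (x : ℝ) : Continuous (psi p x) := by
  unfold psi
  refine Continuous.add ?_ ?_ <;>
  exact Continuous.rpow_const (by fun_prop) (fun _ => Or.inr (by linarith))

lemma psi_convex (p : ℝ) (hp : 3 ≤ p) (x : ℝ) : ConvexOn ℝ (Set.Ici 0) (psi p x) := by
  refine MonotoneOn.convexOn_of_deriv (convex_Ici 0) (psi_cont p hp x).continuousOn ?_ ?_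
  · intro t ht
    rw [interior_Ici] at ht
    exact (psi_deriv p hp x t ht).differentiableAt.differentiableWithinAt
  · intro a ha b hb hab
    rw [interior_Ici] at ha hb
    rw [(psi_deriv p hp x a ha).deriv, (psi_deriv p hp x b hb).deriv]
    have ha' : 0 < √a := Real.sqrt_pos.2 ha
    have hb' : 0 < √b := Real.sqrt_pos.2 hb
    have h := (DD_convex p hp x).slope_mono (x := 0) (by simp)
      (show √a ∈ Set.Ici (0:ℝ) \ {0} from ⟨ha'.le, ha'.ne'⟩)
      (show √b ∈ Set.Ici (0:ℝ) \ {0} from ⟨hb'.le, hb'.ne'⟩) (Real.sqrt_le_sqrt hab)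
    rw [slope_def_field, slope_def_field] at h
    have h0 : DD p x 0 = 0 := by simp [DD]
    rw [h0] at h
    simp only [sub_zero] at h
    have : 0 ≤ p / 2 := by linarith
    gcongr

lemma gauss_int (p : ℝ) (hp : 3 ≤ p) (x : ℝ) (s : NNReal) :
    Integrable (fun y => |x + y| ^ p) (gaussianReal 0 s) := by
  have h : MemLp (fun y : ℝ => x + y) (ENNReal.ofReal p) (gaussianReal 0 s) := by
    refine (memLp_const x).add ?_
    exact memLp_id_gaussianReal' _ (by simp)
  have := h.integrable_norm_rpow (by simp; linarith) (by simp)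
  rw [ENNReal.toReal_ofReal (by linarith)] at this
  exact this

lemma gauss_symm (f : ℝ → ℝ) (s : NNReal) :
    ∫ y, f (-y) ∂(gaussianReal 0 s) = ∫ y, f y ∂(gaussianReal 0 s) := by
  have h : (gaussianReal 0 s).map (fun y => -y) = gaussianReal 0 s := by
    simpa using gaussianReal_map_neg (μ := 0) (v := s)
  conv_rhs => rw [← h]
  exact ((MeasurableEquiv.neg ℝ).measurableEmbedding.integral_map f).symm

lemma jensen (p : ℝ) (hp : 3 ≤ p) (x v : ℝ) :
    (|x + v| ^ p + |x - v| ^ p) / 2 ≤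
      ∫ y, |x + y| ^ p ∂(gaussianReal 0 (Real.toNNReal (v ^ 2))) := by
  set s := Real.toNNReal (v ^ 2) with hs
  have hsq : ∫ y, y ^ 2 ∂(gaussianReal 0 s) = v ^ 2 := by
    have := variance_fun_id_gaussianReal (μ := 0) (v := s)
    rw [variance_eq_integral (by fun_prop)] at this
    simpa [hs, Real.coe_toNNReal _ (sq_nonneg v)] using this
  have hcomp : (psi p x) ∘ (fun y => y ^ 2) = fun y => |x + y| ^ p + |x - y| ^ p := by
    funext y
    simp only [Function.comp, psi, Real.sqrt_sq_eq_abs]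
    rcases abs_cases y with ⟨h, _⟩ | ⟨h, _⟩ <;> rw [h]
    rw [add_comm, sub_neg_eq_add, ← sub_eq_add_neg]
  have hi1 := gauss_int p hp x s
  have hi2 : Integrable (fun y => |x - y| ^ p) (gaussianReal 0 s) := by
    have := gauss_int p hp (-x) s
    refine this.congr (Filter.Eventually.of_forall fun y => ?_)
    simp only
    rw [← abs_neg]; congr 2; ring
  have hi : Integrable ((psi p x) ∘ (fun y => y ^ 2)) (gaussianReal 0 s) := by
    rw [hcomp]; exact hi1.add hi2
  have hi3 : Integrable (fun y : ℝ => y ^ 2) (gaussianReal 0 s) :=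
    (memLp_id_gaussianReal' 2 (by simp)).integrable_sq
  have hJ := (psi_convex p hp x).map_integral_le (psi_cont p hp x).continuousOn isClosed_Ici
    (Filter.Eventually.of_forall fun y : ℝ => (sq_nonneg y : y ^ 2 ∈ Set.Ici 0)) hi3 hi
  rw [hsq] at hJ
  have e1 := congrFun hcomp v
  have e2 : ∫ y, psi p x (y ^ 2) ∂(gaussianReal 0 s) = ∫ y, |x + y| ^ p + |x - y| ^ p ∂(gaussianReal 0 s) := by
    congr 1
  simp only [Function.comp] at e1
  rw [e1, e2, integral_add hi1 hi2] at hJ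
  have := gauss_symm (fun y => |x + y| ^ p) s
  simp only [← sub_eq_add_neg] at this
  rw [this] at hJ
  linarith

lemma gauss_conv (p : ℝ) (hp : 3 ≤ p) (x : ℝ) (s t : NNReal) :
    ∫ y, |x + y| ^ p ∂(gaussianReal 0 (s + t)) =
    ∫ y, ∫ z, |(x + y) + z| ^ p ∂(gaussianReal 0 t) ∂(gaussianReal 0 s) ∧
    Integrable (fun y => ∫ z, |(x + y) + z| ^ p ∂(gaussianReal 0 t)) (gaussianReal 0 s) := by
  have h := gaussianReal_conv_gaussianReal (m₁ := 0) (m₂ := 0) (v₁ := s) (v₂ := t)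
  rw [add_zero] at h
  have hi := gauss_int p hp x (s + t)
  rw [← h] at hi ⊢
  constructor
  · rw [integral_conv hi]
    simp only [add_assoc]
  · unfold Measure.conv at hi
    rw [integrable_map_measure hi.1 (by fun_prop)] at hi
    have := hi.integral_prod_left
    simpa [Function.comp, add_assoc] using this

lemma gauss_moment (p : ℝ) (hp : 3 ≤ p) (s : NNReal) :
    ∫ y, |y| ^ p ∂(gaussianReal 0 s) = (2 ^ (p / 2) * Real.Gamma ((p + 1) / 2) / Real.sqrt Real.pi) * (s:ℝ) ^ (p/2) := by
  have h1 : ∫ y, |y| ^ p ∂(gaussianReal 0 1) = (2 ^ (p / 2) * Real.Gamma ((p + 1) / 2) / Real.sqrt Real.pi) := by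
    rw [integral_gaussianReal_eq_integral_smul (by norm_num)]
    simp only [gaussianPDFReal, smul_eq_mul]
    have := integral_rpow_mul_exp_neg_mul_rpow (p := 2) (q := p) (b := 1/2) (by norm_num) (by linarith) (by norm_num)
    have h2 := integral_comp_abs (f := fun y : ℝ => (√(2 * Real.pi))⁻¹ * (y ^ p * Real.exp (- (1/2) * y ^ (2:ℝ))))
    simp only [integral_const_mul] at h2
    rw [this] at h2
    have e : ∀ y : ℝ, (√(2 * Real.pi * ((1:NNReal):ℝ)))⁻¹ * Real.exp (-(y - 0) ^ 2 / (2 * ((1:NNReal):ℝ))) * |y| ^ p = (√(2 * Real.pi))⁻¹ * (|y| ^ p * Real.exp (- (1/2) * |y| ^ (2:ℝ))) := by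
      intro y
      simp only [NNReal.coe_one, mul_one, sub_zero, Real.rpow_two, sq_abs]
      rw [show -y ^ 2 / 2 = -(1/2) * y ^ 2 by ring]
      ring
    simp only [e, integral_const_mul]
    rw [h2]
    rw [Real.sqrt_mul (by norm_num), one_div, Real.inv_rpow (by norm_num), ← Real.rpow_neg (by norm_num), Real.sqrt_eq_rpow 2]
    have h3 : (2:ℝ) ^ (- (-(p+1)/2)) = 2 ^ (p/2) * 2 ^ ((1:ℝ)/2) := by
      rw [← Real.rpow_add (by norm_num)]; congr 1; ring
    rw [h3]
    have h4 : (0:ℝ) < 2 ^ ((1:ℝ)/2) := by positivity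
    have h5 := Real.sqrt_pos.2 Real.pi_pos
    field_simp
  have h2 : (gaussianReal 0 1).map (fun y => √s * y) = gaussianReal 0 s := by
    rw [gaussianReal_map_const_mul]
    congr 1
    · simp
    · ext; simp
  rw [← h2, integral_map (by fun_prop) (by
    refine Continuous.aestronglyMeasurable ?_
    exact Continuous.rpow_const (by fun_prop) (fun _ => Or.inr (by linarith)))]
  simp only [abs_mul, abs_of_nonneg (Real.sqrt_nonneg _)]
  have : ∀ y : ℝ, (√(s:ℝ) * |y|) ^ p = (s:ℝ) ^ (p/2) * |y| ^ p := by
    intro y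
    rw [Real.mul_rpow (Real.sqrt_nonneg _) (abs_nonneg _), Real.sqrt_eq_rpow, ← Real.rpow_mul (by positivity)]
    congr 2; ring
  simp only [this]
  rw [integral_const_mul, h1, mul_comm]

noncomputable def BB (p : ℝ) : ℝ := 2 ^ (p / 2) * Real.Gamma ((p + 1) / 2) / Real.sqrt Real.pi

lemma gamma_up : Real.eulerMascheroniConstant < 0.5932 := by
  refine (Real.eulerMascheroniConstant_lt_eulerMascheroniSeq' 32).trans ?_
  have h : Real.log 32 = 5 * Real.log 2 := by
    rw [show (32:ℝ) = 2 ^ 5 by norm_num, Real.log_pow]; norm_num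
  have h2 := Real.log_two_gt_d9
  simp only [Real.eulerMascheroniSeq']
  norm_num [harmonic, Finset.sum_range_succ]
  rw [h]; linarith

lemma tan2 (y : ℝ) (hy : 3/2 ≤ y) :
    Real.log (Real.Gamma (3/2)) + (2 - Real.eulerMascheroniConstant - 2 * Real.log 2) * (y - 3/2)
      ≤ Real.log (Real.Gamma y) := by
  rcases hy.eq_or_lt with rfl | hy
  · simp
  have hg := Real.Gamma_add_one (s := 1/2) (by norm_num)
  have hG : Real.Gamma (3/2) = 1/2 * √Real.pi := by
    rw [← Real.Gamma_one_half_eq, ← hg]; norm_num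
  have hpi : 0 < √Real.pi := Real.sqrt_pos.2 Real.pi_pos
  have hd : HasDerivAt Real.Gamma (√Real.pi + 1/2 * (-√Real.pi * (Real.eulerMascheroniConstant + 2 * Real.log 2))) (3/2) := by
    have h1 : HasDerivAt (fun s : ℝ => (s - 1) * Real.Gamma (s - 1)) (1 * Real.Gamma (3/2-1) + (3/2-1) * (-√Real.pi * (Real.eulerMascheroniConstant + 2 * Real.log 2) )) (3/2) := by
      refine ((hasDerivAt_id _).sub_const _).mul ?_
      have := Real.hasDerivAt_Gamma_one_half
      rw [show (1/2:ℝ) = 3/2 - 1 by norm_num] at this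
      simpa using this.comp_sub_const (3/2) 1
    have h2 := h1.congr_of_eventuallyEq (f₁ := Real.Gamma) (by
      filter_upwards [lt_mem_nhds (show (1:ℝ) < 3/2 by norm_num)] with s hs
      have := Real.Gamma_add_one (s := s - 1) (by linarith)
      rw [← this]; simp)
    refine h2.congr_deriv ?_
    rw [show (3/2 - 1 : ℝ) = 1/2 by norm_num, Real.Gamma_one_half_eq]; ring
  have hd2 : HasDerivAt (Real.log ∘ Real.Gamma) _ (3/2) := hd.log (by rw [hG]; positivity)
  have := Real.convexOn_log_Gamma.le_slope_of_hasDerivAt (x := 3/2) (y := y)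
    (by simp) (by simp; linarith) hy hd2
  rw [slope_def_field, le_div_iff₀ (by linarith)] at this
  simp only [Function.comp] at this
  have e : (√Real.pi + 1/2 * (-√Real.pi * (Real.eulerMascheroniConstant + 2 * Real.log 2))) / Real.Gamma (3/2) = 2 - Real.eulerMascheroniConstant - 2 * Real.log 2 := by
    rw [hG]; field_simp; ring
  rw [e] at this
  linarith

lemma tan3 (y : ℝ) (hy0 : 0 < y) (hy : y ≤ 2) :
    (1 - Real.eulerMascheroniConstant) * (y - 2) ≤ Real.log (Real.Gamma y) := by
  rcases hy.eq_or_lt with rfl | hy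
  · simp [Real.Gamma_two]
  have hd : HasDerivAt Real.Gamma (1 - Real.eulerMascheroniConstant) 2 := by
    have := Real.hasDerivAt_Gamma_nat 1
    norm_num [harmonic] at this
    convert this using 1; ring
  have hd2 : HasDerivAt (Real.log ∘ Real.Gamma) _ 2 := hd.log (by simp [Real.Gamma_two])
  have := Real.convexOn_log_Gamma.slope_le_of_hasDerivAt (x := y) (y := 2)
    (by simpa using hy0) (by simp) hy hd2
  rw [slope_def_field, div_le_iff₀ (by linarith)] at this
  simp only [Function.comp, Real.Gamma_two, Real.log_one, div_one] at this
  linarith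

lemma BB_pos (p : ℝ) (hp : 2 ≤ p) : 0 < BB p := by
  have := Real.Gamma_pos_of_pos (s := (p+1)/2) (by linarith)
  have := Real.pi_pos
  unfold BB; positivity

lemma log_BB (p : ℝ) (hp : 2 ≤ p) : Real.log (BB p) = p / 2 * Real.log 2 + Real.log (Real.Gamma ((p+1)/2)) - Real.log (√Real.pi) := by
  have h1 := Real.Gamma_pos_of_pos (s := (p+1)/2) (by linarith)
  have := Real.sqrt_pos.2 Real.pi_pos
  unfold BB
  rw [Real.log_div (by positivity) (by positivity), Real.log_mul (by positivity) (by positivity), Real.log_rpow (by norm_num)]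

lemma BB_lower2 (p : ℝ) (hp : 2 ≤ p) : (0.49:ℝ) ^ (-((p - 2) / 2)) ≤ BB p := by
  rw [← Real.log_le_log_iff (by positivity) (BB_pos p hp), Real.log_rpow (by norm_num), log_BB p hp]
  have h := tan2 ((p+1)/2) (by linarith)
  have hG : Real.Gamma (3/2) = 1/2 * √Real.pi := by
    rw [← Real.Gamma_one_half_eq, ← Real.Gamma_add_one (s := 1/2) (by norm_num)]; norm_num
  have hpi : 0 < √Real.pi := Real.sqrt_pos.2 Real.pi_pos
  rw [hG, Real.log_mul (by norm_num) (by positivity), one_div, Real.log_inv] at h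
  have hg := gamma_up
  have hl := Real.log_two_lt_d9
  have hl' := Real.log_two_gt_d9
  have h49 : -0.7136 ≤ Real.log 0.49 := by
    rw [Real.le_log_iff_exp_le (by norm_num), Real.exp_neg, inv_le_comm₀ (by positivity) (by norm_num)]
    refine le_trans ?_ (Real.sum_le_exp_of_nonneg (by norm_num) 8)
    norm_num [Finset.sum_range_succ, Nat.factorial]
  have : 0 ≤ (p - 2) * (Real.log 2 + (2 - Real.eulerMascheroniConstant - 2 * Real.log 2) + Real.log 0.49) := by
    apply mul_nonneg (by linarith); linarith
  nlinarith

lemma BB_three : BB 3 = √(8 / Real.pi) := by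
  unfold BB
  rw [show ((3:ℝ)+1)/2 = 2 by norm_num, Real.Gamma_two, mul_one, Real.sqrt_div (by norm_num), Real.sqrt_eq_rpow 8, show (8:ℝ) = 2 ^ (3:ℝ) by norm_num, ← Real.rpow_mul (by norm_num)]
  norm_num

lemma BB_lower3 (p : ℝ) (hp : 2 ≤ p) (hp3 : p ≤ 3) : BB 3 * (0.3:ℝ) ^ ((3 - p) / 2) ≤ BB p := by
  have h3 := BB_pos 3 (by norm_num)
  rw [← Real.log_le_log_iff (by positivity) (BB_pos p hp), Real.log_mul (by positivity) (by positivity), Real.log_rpow (by norm_num), log_BB p hp, log_BB 3 (by norm_num)]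
  have h := tan3 ((p+1)/2) (by linarith) (by linarith)
  rw [show ((3:ℝ)+1)/2 = 2 by norm_num, Real.Gamma_two, Real.log_one]
  have hg := Real.one_half_lt_eulerMascheroniConstant
  have hl := Real.log_two_lt_d9
  have h49 : Real.log 0.3 ≤ -1.2 := by
    rw [Real.log_le_iff_le_exp (by norm_num), Real.exp_neg, le_inv_comm₀ (by norm_num) (by positivity)]
    have h6 : Real.exp 0.6 ≤ 1.825 := by
      refine le_trans (Real.exp_bound' (n := 6) (x := 0.6) ?_ ?_ ?_) ?_ <;>
      norm_num [Finset.sum_range_succ, Nat.factorial]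
    rw [show (1.2:ℝ) = 0.6 + 0.6 by norm_num, Real.exp_add]
    have := Real.exp_pos 0.6
    norm_num at h6 this ⊢
    nlinarith
  have : 0 ≤ (3 - p) * (-Real.log 0.3 - (Real.log 2 + (1 - Real.eulerMascheroniConstant))) := by
    apply mul_nonneg (by linarith); linarith
  nlinarith


lemma cos_le_exp (u : ℝ) (hu : |u| ≤ Real.pi / 2) : Real.cos u ≤ Real.exp (-(u ^ 2 / 2)) := by
  wlog h0 : 0 ≤ u generalizing u
  · have := this (-u) (by rwa [abs_neg]) (by linarith)
    simpa using this
  rw [abs_of_nonneg h0] at hu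
  have hanti : AntitoneOn (fun u : ℝ => Real.cos u * Real.exp (u ^ 2 / 2)) (Set.Icc 0 (Real.pi/2)) := by
    have hd : ∀ u : ℝ, HasDerivAt (fun u : ℝ => Real.cos u * Real.exp (u ^ 2 / 2))
        ((u * Real.cos u - Real.sin u) * Real.exp (u ^ 2 / 2)) u := by
      intro u
      have h1 : HasDerivAt (fun u : ℝ => u ^ 2 / 2) u u := by
        refine ((hasDerivAt_pow 2 u).div_const 2).congr_deriv ?_
        simp
      refine ((Real.hasDerivAt_cos u).mul h1.exp).congr_deriv ?_
      ring
    refine antitoneOn_of_deriv_nonpos (convex_Icc _ _) (fun u _ => (hd u).continuousAt.continuousWithinAt)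
      (fun u _ => (hd u).differentiableAt.differentiableWithinAt) ?_
    intro u hu
    rw [interior_Icc] at hu
    rw [(hd u).deriv]
    have hc : 0 < Real.cos u := Real.cos_pos_of_mem_Ioo ⟨by linarith [hu.1], hu.2⟩
    have ht := Real.le_tan hu.1.le hu.2
    rw [Real.tan_eq_sin_div_cos, le_div_iff₀ hc] at ht
    exact mul_nonpos_of_nonpos_of_nonneg (by linarith) (Real.exp_pos _).le
  have := hanti (show (0:ℝ) ∈ Set.Icc 0 (Real.pi/2) from ⟨le_rfl, by linarith [Real.pi_pos]⟩) ⟨h0, hu⟩ h0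
  simp only [Real.cos_zero, one_mul] at this
  rw [Real.exp_neg, ← one_div, le_div_iff₀ (Real.exp_pos _)]
  simpa using this

lemma exp_chord (s : ℝ) (h1 : 0.3 ≤ s) (h2 : s ≤ 0.49) : Real.exp (-(6.48 * s)) ≤ 0.295 - 0.5 * s := by
  have a1 : Real.exp (-(1.944)) ≤ 0.145 := by
    rw [Real.exp_neg, inv_le_comm₀ (by positivity) (by norm_num)]
    refine le_trans ?_ (Real.sum_le_exp_of_nonneg (by norm_num) 10)
    norm_num [Finset.sum_range_succ, Nat.factorial]
  have a2 : Real.exp (-(3.1752)) ≤ 0.05 := by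
    rw [Real.exp_neg, inv_le_comm₀ (by positivity) (by norm_num)]
    refine le_trans ?_ (Real.sum_le_exp_of_nonneg (by norm_num) 10)
    norm_num [Finset.sum_range_succ, Nat.factorial]
  have w1 : 0 ≤ (0.49 - s) / 0.19 := by apply div_nonneg <;> linarith
  have w2 : 0 ≤ (s - 0.3) / 0.19 := by apply div_nonneg <;> linarith
  have h := convexOn_exp.2 (Set.mem_univ (-(1.944))) (Set.mem_univ (-(3.1752))) w1 w2 (by ring)
  simp only [smul_eq_mul] at h
  rw [show (0.49 - s) / 0.19 * -1.944 + (s - 0.3) / 0.19 * -3.1752 = -(6.48 * s) by ring] at h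
  have t1 := mul_le_mul_of_nonneg_left a1 w1
  have t2 := mul_le_mul_of_nonneg_left a2 w2
  exact h.trans ((add_le_add t1 t2).trans_eq (by ring))

lemma cos_prod (n : ℕ) (v : Fin n → ℝ) (s : ℝ) (hv : ∑ i, v i ^ 2 = s) (h1 : 0.3 ≤ s) (h2 : s ≤ 0.49) :
    ∏ i, Real.cos (3.6 * v i) ≤ 0.295 - 0.5 * s := by
  set u : Fin n → ℝ := fun i => |3.6 * v i| with hu
  have hc : ∀ i, Real.cos (3.6 * v i) = Real.cos (u i) := fun i => (Real.cos_abs _).symm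
  have hu0 : ∀ i, 0 ≤ u i := fun i => abs_nonneg _
  have hsum : ∑ i, u i ^ 2 = 12.96 * s := by
    rw [← hv, Finset.mul_sum]
    refine Finset.sum_congr rfl fun i _ => ?_
    simp only [hu, sq_abs]; ring
  simp only [hc]
  clear_value u
  have hpi := Real.pi_gt_d4
  have hpi2 := Real.pi_lt_d4
  by_cases hA : ∀ i, u i ≤ Real.pi / 2
  · refine le_trans (Finset.prod_le_prod (g := fun i => Real.exp (-(u i ^ 2 / 2))) (fun i _ => ?_) (fun i _ => ?_)) ?_
    · exact Real.cos_nonneg_of_mem_Icc ⟨by linarith [hu0 i], hA i⟩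
    · exact cos_le_exp _ (by rw [abs_of_nonneg (hu0 i)]; exact hA i)
    · rw [← Real.exp_sum, Finset.sum_neg_distrib, ← Finset.sum_div, hsum]
      rw [show -(12.96 * s / 2) = -(6.48 * s) by ring]
      exact exp_chord s h1 h2
  push Not at hA
  obtain ⟨i, hi⟩ := hA
  have hi2 : u i ≤ 3 := by
    have : u i ^ 2 ≤ 12.96 * s := by
      rw [← hsum]; exact Finset.single_le_sum (f := fun i => u i ^ 2) (fun j _ => sq_nonneg _) (Finset.mem_univ i)
    nlinarith [hu0 i]
  have hci : Real.cos (u i) ≤ 0 := Real.cos_nonpos_of_pi_div_two_le_of_le hi.le (by linarith)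
  rw [← Finset.mul_prod_erase _ _ (Finset.mem_univ i)]
  rw [← Finset.add_sum_erase _ _ (Finset.mem_univ i)] at hsum
  by_cases hB : ∀ j ∈ Finset.univ.erase i, u j ≤ Real.pi / 2
  · have : 0 ≤ ∏ j ∈ Finset.univ.erase i, Real.cos (u j) :=
      Finset.prod_nonneg fun j hj => Real.cos_nonneg_of_mem_Icc ⟨by linarith [hu0 j], hB j hj⟩
    have := mul_nonpos_of_nonpos_of_nonneg hci this
    linarith
  push Not at hB
  obtain ⟨j, hj, hjb⟩ := hB
  rw [← Finset.mul_prod_erase _ _ hj]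
  rw [← Finset.add_sum_erase _ _ hj] at hsum
  have hnn : 0 ≤ ∑ k ∈ (Finset.univ.erase i).erase j, u k ^ 2 := Finset.sum_nonneg fun k _ => sq_nonneg _
  have hC : ∀ k ∈ (Finset.univ.erase i).erase j, u k ≤ Real.pi / 2 := by
    intro k hk
    by_contra hk'
    push Not at hk'
    have := Finset.single_le_sum (f := fun i => u i ^ 2) (fun j _ => sq_nonneg _) hk
    nlinarith
  have hP0 : 0 ≤ ∏ k ∈ (Finset.univ.erase i).erase j, Real.cos (u k) :=
    Finset.prod_nonneg fun k hk => Real.cos_nonneg_of_mem_Icc ⟨by linarith [hu0 k], hC k hk⟩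
  have hP1 : ∏ k ∈ (Finset.univ.erase i).erase j, Real.cos (u k) ≤ 1 :=
    Finset.prod_le_one (fun k hk => Real.cos_nonneg_of_mem_Icc ⟨by linarith [hu0 k], hC k hk⟩) fun k _ => Real.cos_le_one _
  have hcb : ∀ a : ℝ, Real.pi/2 ≤ a → -Real.cos a ≤ a - Real.pi / 2 := by
    intro a ha
    have := Real.sin_le (x := a - Real.pi/2) (by linarith)
    rwa [Real.sin_sub_pi_div_two] at this
  have hj2 : u j ≤ 3 := by nlinarith [hu0 j, sq_nonneg (u i)]
  have hcj : Real.cos (u j) ≤ 0 := Real.cos_nonpos_of_pi_div_two_le_of_le hjb.le (by linarith)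
  have hij : Real.cos (u i) * Real.cos (u j) ≤ 0.05 := by
    have e1 : Real.cos (u i) * Real.cos (u j) ≤ (u i - Real.pi / 2) * (u j - Real.pi / 2) := by
      rw [← neg_mul_neg]
      exact mul_le_mul (hcb _ hi.le) (hcb _ hjb.le) (by linarith) (by linarith)
    have e2 : u i + u j ≤ 3.565 := by nlinarith [sq_nonneg (u i - u j)]
    nlinarith [sq_nonneg (u i - u j)]
  have : Real.cos (u i) * (Real.cos (u j) * ∏ k ∈ (Finset.univ.erase i).erase j, Real.cos (u k)) ≤ 0.05 := by
    rw [← mul_assoc]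
    have := mul_nonneg_of_nonpos_of_nonpos hci hcj
    nlinarith
  linarith

lemma cos36 : -0.9 ≤ Real.cos 3.6 := by
  have hpi := Real.pi_gt_d4
  have hpi2 := Real.pi_lt_d4
  have h := Real.cos_bound (x := 3.6 - Real.pi) (by rw [abs_le]; constructor <;> linarith)
  rw [Real.cos_sub_pi, abs_le] at h
  have ha : |3.6 - Real.pi| = 3.6 - Real.pi := abs_of_nonneg (by linarith)
  rw [ha] at h
  have h4 : (3.6 - Real.pi) ^ 4 ≤ 0.4585 ^ 4 := by gcongr <;> linarith
  have h5 : (0.4584:ℝ) ^ 2 ≤ (3.6 - Real.pi) ^ 2 := by gcongr; linarith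
  norm_num at *
  linarith

lemma h_bound (y : ℝ) (hy : 1 ≤ |y|) : 4.58 ≤ 6.48 * y ^ 2 + 1 * Real.cos (3.6 * y) + (-1) := by
  rw [← sq_abs, ← Real.cos_abs, abs_mul, abs_of_nonneg (by norm_num : (0:ℝ) ≤ 3.6)]
  generalize |y| = z at *
  have hd : ∀ z : ℝ, HasDerivAt (fun z : ℝ => 6.48 * z ^ 2 + 1 * Real.cos (3.6 * z) + (-1)) (3.6 * (3.6 * z - Real.sin (3.6 * z))) z := by
    intro z
    have h1 : HasDerivAt (fun z : ℝ => 3.6 * z) 3.6 z := by simpa using (hasDerivAt_id z).const_mul 3.6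
    refine ((((hasDerivAt_pow 2 z).const_mul 6.48).add (h1.cos.const_mul 1)).add_const _).congr_deriv ?_
    simp; ring
  have hm : MonotoneOn (fun z : ℝ => 6.48 * z ^ 2 + 1 * Real.cos (3.6 * z) + (-1)) (Set.Ici 1) := by
    refine monotoneOn_of_deriv_nonneg (convex_Ici _) (fun u _ => (hd u).continuousAt.continuousWithinAt)
      (fun u _ => (hd u).differentiableAt.differentiableWithinAt) ?_
    intro u hu
    rw [interior_Ici] at hu
    rw [(hd u).deriv]
    have : (1:ℝ) < u := hu
    have := Real.sin_le (x := 3.6 * u) (by linarith)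
    linarith
  have := hm (show (1:ℝ) ∈ Set.Ici 1 from Set.mem_Ici.2 le_rfl) hy hy
  simp only [mul_one] at this
  have := cos36
  linarith

lemma h_nonneg (y : ℝ) : 0 ≤ 6.48 * y ^ 2 + 1 * Real.cos (3.6 * y) + (-1) := by
  have := Real.one_sub_sq_div_two_le_cos (x := 3.6 * y)
  nlinarith

lemma khintchine (p : ℝ) (hp : 3 ≤ p) (n : ℕ) : ∀ (v : Fin n → ℝ) (x : ℝ),
    radE n v (fun y => |y| ^ p) x ≤
      ∫ y, |x + y| ^ p ∂(gaussianReal 0 (Real.toNNReal (∑ i, v i ^ 2))) := by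
  induction n with
  | zero => intro v x; simp [radE_zero]
  | succ n ih =>
    intro v x
    rw [radE_succ, Fin.sum_univ_succ, add_comm (v 0 ^ 2), Real.toNNReal_add (Finset.sum_nonneg fun i _ => sq_nonneg _) (sq_nonneg _)]
    obtain ⟨e, hi⟩ := gauss_conv p hp x (∑ i : Fin n, v i.succ ^ 2).toNNReal (v 0 ^ 2).toNNReal
    have hi' := hi
    rw [e]
    have h1 := ih (fun i => v i.succ) (x + v 0)
    have h2 := ih (fun i => v i.succ) (x - v 0)
    have i1 := gauss_int p hp (x + v 0) (∑ i : Fin n, v i.succ ^ 2).toNNReal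
    have i2 := gauss_int p hp (x - v 0) (∑ i : Fin n, v i.succ ^ 2).toNNReal
    calc _ ≤ ((∫ y, |x + v 0 + y| ^ p ∂(gaussianReal 0 (Real.toNNReal (∑ i : Fin n, v i.succ ^ 2))))
          + ∫ y, |x - v 0 + y| ^ p ∂(gaussianReal 0 (Real.toNNReal (∑ i : Fin n, v i.succ ^ 2)))) / 2 := by linarith
      _ = ∫ y, (|x + v 0 + y| ^ p + |x - v 0 + y| ^ p) / 2 ∂(gaussianReal 0 (Real.toNNReal (∑ i : Fin n, v i.succ ^ 2))) := by
          rw [integral_div, integral_add i1 i2]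
      _ ≤ _ := by
          refine integral_mono ((i1.add i2).div_const 2) hi fun y => ?_
          have := jensen p hp (x + y) (v 0)
          simp only
          rwa [show x + v 0 + y = x + y + v 0 by ring, show x - v 0 + y = x + y - v 0 by ring]

lemma tail_p (p : ℝ) (hp : 3 ≤ p) (n : ℕ) (v : Fin n → ℝ) :
    radE n v ind 0 ≤ BB p * (∑ i, v i ^ 2) ^ (p / 2) := by
  have h := khintchine p hp n v 0
  simp only [zero_add] at h
  rw [gauss_moment p hp, Real.coe_toNNReal _ (Finset.sum_nonneg fun i _ => sq_nonneg _)] at h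
  refine le_trans (radE_mono n v _ _ 0 fun y => ?_) h
  unfold ind
  split_ifs with hy
  · positivity
  · exact Real.one_le_rpow (by linarith) (by linarith)

lemma tail_2 (n : ℕ) (v : Fin n → ℝ) : radE n v ind 0 ≤ ∑ i, v i ^ 2 := by
  have h := radE_sq n v 0
  rw [show (0:ℝ) ^ 2 + ∑ i, v i ^ 2 = ∑ i, v i ^ 2 by ring] at h
  rw [← h]
  refine radE_mono n v _ _ 0 fun y => ?_
  unfold ind
  split_ifs with hy
  · positivity
  · rw [← sq_abs]; nlinarith

lemma tail_cos (n : ℕ) (v : Fin n → ℝ) (s : ℝ) (hv : ∑ i, v i ^ 2 = s) (h1 : 0.3 ≤ s) (h2 : s ≤ 0.49) :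
    4.58 * radE n v ind 0 ≤ 5.98 * s - 0.705 := by
  have h := radE_lin n v (fun y => y ^ 2) (fun y => Real.cos (3.6 * y)) 0 6.48 1 (-1)
  rw [radE_sq, radE_cos, hv, mul_zero, Real.cos_zero] at h
  have hc := cos_prod n v s hv h1 h2
  have hl := radE_lin n v ind ind 0 4.58 0 0
  have hm := radE_mono n v (fun y => 4.58 * ind y + 0 * ind y + 0) (fun y => 6.48 * y ^ 2 + 1 * Real.cos (3.6 * y) + (-1)) 0 (by
    intro y
    simp only [ind]
    split_ifs with hy
    · have := h_nonneg y; linarith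
    · have := h_bound y (by linarith); linarith)
  rw [hl, h] at hm
  linarith

lemma mid_lower (p s : ℝ) (hp : 2 ≤ p) (hp3 : p ≤ 3) (h1 : 0.3 ≤ s) (h2 : s ≤ 0.49) :
    s * (s / 0.49) ^ (0.28:ℝ) ≤ BB p * s ^ (p / 2) := by
  have hs : 0 < s := by linarith
  by_cases hq : p - 2 ≤ 0.56
  · have h := BB_lower2 p hp
    calc s * (s / 0.49) ^ (0.28:ℝ) ≤ s * (s / 0.49) ^ ((p-2)/2) := by
          gcongr s * ?_
          apply Real.rpow_le_rpow_of_exponent_ge (by positivity)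
          · rw [div_le_one (by norm_num)]; exact h2
          · linarith
      _ = (0.49:ℝ) ^ (-((p - 2) / 2)) * s ^ (p/2) := by
          rw [Real.div_rpow hs.le (by norm_num), Real.rpow_neg (by norm_num),
            show p / 2 = 1 + (p-2)/2 by ring, Real.rpow_add hs, Real.rpow_one]
          ring
      _ ≤ _ := by gcongr
  · have h := BB_lower3 p hp hp3
    have hpi := Real.pi_lt_d4
    have hpi0 := Real.pi_pos
    have key : 1 ≤ √(8 / Real.pi) * √0.3 * (0.49 / 0.3 : ℝ) ^ (0.28:ℝ) := by
      have a1 : (Real.pi / 2.4) ^ (1/2 : ℝ) ≤ (0.49 / 0.3 : ℝ) ^ (0.28:ℝ) := by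
        rw [← Real.rpow_le_rpow_iff (z := 50) (by positivity) (by positivity) (by norm_num), ← Real.rpow_mul (by positivity), ← Real.rpow_mul (by positivity)]
        norm_num
        have : Real.pi / (12/5) ≤ 1.30902 := by rw [div_le_iff₀ (by norm_num)]; norm_num at *; linarith
        calc (Real.pi / (12/5)) ^ 25 ≤ 1.30902 ^ 25 := by gcongr
          _ ≤ _ := by norm_num
      rw [← Real.sqrt_eq_rpow] at a1
      rw [← Real.sqrt_mul (by positivity)]
      have a2 : √(8 / Real.pi * 0.3) * √(Real.pi / 2.4) = 1 := by
        rw [← Real.sqrt_mul (by positivity), show 8 / Real.pi * 0.3 * (Real.pi / 2.4) = 1 by field_simp; norm_num, Real.sqrt_one]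
      rw [← a2]; gcongr
    have hs3 : 1 ≤ s / 0.3 := by rw [le_div_iff₀ (by norm_num)]; linarith
    calc s * (s / 0.49) ^ (0.28:ℝ) ≤ s * (s / 0.49) ^ (0.28:ℝ) * (√(8 / Real.pi) * √0.3 * (0.49 / 0.3 : ℝ) ^ (0.28:ℝ)) := by
          exact le_mul_of_one_le_right (by positivity) key
      _ = √(8 / Real.pi) * √0.3 * s * (s / 0.3) ^ (0.28:ℝ) := by
          have : (s / 0.3) = s / 0.49 * (0.49 / 0.3) := by field_simp
          rw [this, Real.mul_rpow (by positivity) (by positivity)]; ring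
      _ ≤ √(8 / Real.pi) * √0.3 * s * (s / 0.3) ^ ((p - 2)/2) := by
          gcongr √(8 / Real.pi) * √0.3 * s * ?_
          exact Real.rpow_le_rpow_of_exponent_le hs3 (by linarith)
      _ = BB 3 * (0.3:ℝ) ^ ((3 - p) / 2) * s ^ (p/2) := by
          rw [BB_three, Real.div_rpow hs.le (by norm_num), show (3 - p)/2 = 1/2 - (p-2)/2 by ring,
            Real.rpow_sub (by norm_num), ← Real.sqrt_eq_rpow,
            show p / 2 = 1 + (p-2)/2 by ring, Real.rpow_add hs, Real.rpow_one]
          ring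
      _ ≤ _ := by gcongr

lemma tail (p : ℝ) (hp : 2 ≤ p) (n : ℕ) (v : Fin n → ℝ) :
    radE n v ind 0 ≤ BB p * (∑ i, v i ^ 2) ^ (p / 2) := by
  rcases le_total 3 p with hp3 | hp3
  · exact tail_p p hp3 n v
  have t3 := tail_p 3 le_rfl n v
  have t2 := tail_2 n v
  have tc := tail_cos n v _ rfl
  have hs0 : 0 ≤ ∑ i, v i ^ 2 := Finset.sum_nonneg fun i _ => sq_nonneg _
  generalize ∑ i, v i ^ 2 = s at *
  have hB3 := BB_pos 3 (by norm_num)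
  have hB := BB_pos p hp
  rcases hs0.eq_or_lt with rfl | hs
  · refine t2.trans ?_
    positivity
  rcases le_total 0.49 s with h | h
  · refine t2.trans ?_
    have hl := BB_lower2 p hp
    calc s ≤ s * (s / 0.49) ^ ((p-2)/2) := by
          refine le_mul_of_one_le_right hs.le (Real.one_le_rpow ?_ (by linarith))
          rw [le_div_iff₀ (by norm_num)]; linarith
      _ = (0.49:ℝ) ^ (-((p - 2) / 2)) * s ^ (p/2) := by
          rw [Real.div_rpow hs.le (by norm_num), Real.rpow_neg (by norm_num),
            show p / 2 = 1 + (p-2)/2 by ring, Real.rpow_add hs, Real.rpow_one]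
          ring
      _ ≤ _ := by gcongr
  rcases le_total s 0.3 with h' | h'
  · refine t3.trans ?_
    have hl := BB_lower3 p hp hp3
    calc BB 3 * s ^ ((3:ℝ)/2) = BB 3 * s ^ ((3 - p)/2) * s ^ (p/2) := by
          rw [mul_assoc, ← Real.rpow_add hs]; congr 2; ring
      _ ≤ BB 3 * 0.3 ^ ((3 - p)/2) * s ^ (p/2) := by
          gcongr
      _ ≤ _ := by gcongr
  · refine le_trans ?_ (mid_lower p s hp hp3 h' h)
    have tc := tc h' h
    have hb : (0.49 / s) ^ (0.28:ℝ) ≤ 1 + 0.28 * (0.49 / s - 1) := by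
      have h49 : 0 ≤ 0.49 / s := by positivity
      have := rpow_one_add_le_one_add_mul_self (s := 0.49 / s - 1) (by linarith) (p := 0.28) (by norm_num) (by norm_num)
      rwa [add_sub_cancel] at this
    have hr : (s / 0.49) ^ (0.28:ℝ) = ((0.49 / s) ^ (0.28:ℝ))⁻¹ := by
      rw [← Real.inv_rpow (by positivity), inv_div]
    have hpos : 0 < (0.49 / s) ^ (0.28:ℝ) := by positivity
    have hfin : (5.98 * s - 0.705) / 4.58 * (1 + 0.28 * (0.49 / s - 1)) ≤ s := by
      have : (5.98 * s - 0.705) / 4.58 * (1 + 0.28 * (0.49 / s - 1)) = (5.98 * s - 0.705) / 4.58 * (0.72 * s + 0.1372) / s := by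
        field_simp; ring
      rw [this, div_le_iff₀ hs, div_mul_eq_mul_div, div_le_iff₀ (by norm_num)]
      nlinarith [sq_nonneg (s - 0.57)]
    rw [hr, ← div_eq_mul_inv, le_div_iff₀ hpos]
    have hQ : radE n v ind 0 ≤ (5.98 * s - 0.705) / 4.58 := by
      rw [le_div_iff₀ (by norm_num)]; linarith
    refine le_trans ?_ hfin
    have : 0 ≤ (5.98 * s - 0.705) / 4.58 := by apply div_nonneg <;> linarith
    gcongr

theorem lemma_G (c : ℝ) (hc : 0 ≤ c) (p : ℝ) (hp : 2 ≤ p) (n : ℕ)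
    (x : ℝ) (hx : |x| ≤ 1) (v : Fin n → ℝ)
    (hv : ∑ i, v i ^ 2 ≤ c * (1 + |x|) ^ 2) :
    (1 / 2) * (1 - (2 ^ (p / 2) * Real.Gamma ((p + 1) / 2) / Real.sqrt Real.pi)
        * c ^ (p / 2)) ≤
      (∑ a : Fin n → Bool,
        if |x + ∑ i, (if a i then (1:ℝ) else -1) * v i| ≤ 1 then (1:ℝ) else 0) / 2 ^ n := by
  refine le_trans ?_ (reduction n x hx v)
  have h := tail p hp n (fun i => v i / (1 + |x|))
  have ht : 0 < 1 + |x| := by positivity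
  have hs : ∑ i, (v i / (1 + |x|)) ^ 2 ≤ c := by
    simp only [div_pow]
    rw [← Finset.sum_div, div_le_iff₀ (by positivity)]
    exact hv
  have h2 : BB p * (∑ i, (v i / (1 + |x|)) ^ 2) ^ (p / 2) ≤ BB p * c ^ (p / 2) := by
    have := BB_pos p hp
    have : 0 ≤ p / 2 := by linarith
    gcongr
  have h3 := h.trans h2
  unfold BB at h3
  linarith
end
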